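/- arXiv:0902.1032 — 9 statements merged into one kernel-verified Lean document; each statement's English description precedes it below -/
import Mathlib

section
/- Let R be a commutative ring, let M be an (n+2)×(n+2) matrix over R, and let M₀ denote its top-left n×n submatrix. Then det(M₀)·det(M) = det(M with row n+2 and column n+2 deleted)·det(M with row n+1 and column n+1 deleted) − det(M with row n+2 and column n+1 deleted)·det(M with row n+1 and column n+2 deleted). (In the paper's bordered-determinant notation F[x₁⋯x_k, y₁⋯y_k] = det(F[x_i,y_j]), this is the Tanner identity F[α,β]·F[αxz,βyt] = F[αx,βy]·F[αz,βt] − F[αx,βt]·F[αz,βy].) -/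
namespace Matrix

theorem mvPolynomialX_map_eval₂Hom {ι S : Type*} [CommRing S] (N : Matrix ι ι S) :
    (mvPolynomialX ι ι ℤ).map
      (MvPolynomial.eval₂Hom (Int.castRingHom S) fun p => N p.1 p.2) = N := by
  ext i j
  simp

theorem toBlocks₁₁_map {p q S T : Type*} (N : Matrix (p ⊕ q) (p ⊕ q) S) (f : S → T) :
    (N.map f).toBlocks₁₁ = N.toBlocks₁₁.map f :=
  rfl

variable {R m k l : Type*} [CommRing R] [Fintype m] [DecidableEq m]

/-- A minor bordering an invertible corner block is the determinant of that block times a minor of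
the Schur complement. -/
theorem det_submatrix_sumMap_id [Fintype l] [DecidableEq l] (M : Matrix (m ⊕ k) (m ⊕ k) R)
    [Invertible M.toBlocks₁₁] (f g : l → k) :
    (M.submatrix (Sum.map id f) (Sum.map id g)).det = M.toBlocks₁₁.det *
      ((M.toBlocks₂₂ - M.toBlocks₂₁ * ⅟M.toBlocks₁₁ * M.toBlocks₁₂).submatrix f g).det := by
  have h : M.submatrix (Sum.map id f) (Sum.map id g) =
      fromBlocks M.toBlocks₁₁ (M.toBlocks₁₂.submatrix id g) (M.toBlocks₂₁.submatrix f id)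
        (M.toBlocks₂₂.submatrix f g) := by
    ext (i | i) (j | j) <;> rfl
  rw [h, det_fromBlocks₁₁]
  rfl

theorem det_toBlocks₁₁_mul_det_of_invertible (M : Matrix (m ⊕ Fin 2) (m ⊕ Fin 2) R)
    [Invertible M.toBlocks₁₁] :
    M.toBlocks₁₁.det * M.det =
      (M.submatrix (Sum.map id ![0]) (Sum.map id ![0])).det *
        (M.submatrix (Sum.map id ![1]) (Sum.map id ![1])).det -
      (M.submatrix (Sum.map id ![0]) (Sum.map id ![1])).det *
        (M.submatrix (Sum.map id ![1]) (Sum.map id ![0])).det := by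
  have h := det_submatrix_sumMap_id M id id
  rw [Sum.map_id_id, submatrix_id_id, submatrix_id_id, det_fin_two] at h
  simp only [h, det_submatrix_sumMap_id, det_fin_one, submatrix_apply, cons_val_zero]
  ring

/-- The **Desnanot–Jacobi identity** for a matrix with a distinguished pair of rows and columns. -/
theorem det_toBlocks₁₁_mul_det (M : Matrix (m ⊕ Fin 2) (m ⊕ Fin 2) R) :
    M.toBlocks₁₁.det * M.det =
      (M.submatrix (Sum.map id ![0]) (Sum.map id ![0])).det *
        (M.submatrix (Sum.map id ![1]) (Sum.map id ![1])).det -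
      (M.submatrix (Sum.map id ![0]) (Sum.map id ![1])).det *
        (M.submatrix (Sum.map id ![1]) (Sum.map id ![0])).det := by
  let X := mvPolynomialX (m ⊕ Fin 2) (m ⊕ Fin 2) ℤ
  have hX : X.toBlocks₁₁.det ≠ 0 := by
    intro h
    have h1 := congrArg (MvPolynomial.eval₂Hom (Int.castRingHom ℤ)
      fun p => (1 : Matrix (m ⊕ Fin 2) (m ⊕ Fin 2) ℤ) p.1 p.2) h
    rw [RingHom.map_det, RingHom.mapMatrix_apply, map_zero,
      ← toBlocks₁₁_map, mvPolynomialX_map_eval₂Hom, ← fromBlocks_one,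
      toBlocks_fromBlocks₁₁, det_one] at h1
    exact one_ne_zero h1
  have key : X.toBlocks₁₁.det * X.det =
      (X.submatrix (Sum.map id ![0]) (Sum.map id ![0])).det *
        (X.submatrix (Sum.map id ![1]) (Sum.map id ![1])).det -
      (X.submatrix (Sum.map id ![0]) (Sum.map id ![1])).det *
        (X.submatrix (Sum.map id ![1]) (Sum.map id ![0])).det := by
    let K := FractionRing (MvPolynomial ((m ⊕ Fin 2) × (m ⊕ Fin 2)) ℤ)
    let φ := algebraMap (MvPolynomial ((m ⊕ Fin 2) × (m ⊕ Fin 2)) ℤ) K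
    have hφ : Function.Injective φ := IsFractionRing.injective _ _
    have hdet : (X.map φ).toBlocks₁₁.det ≠ 0 := by
      change (φ.mapMatrix X.toBlocks₁₁).det ≠ 0
      rw [← RingHom.map_det]
      exact (map_ne_zero_iff φ hφ).2 hX
    let := invertibleOfIsUnitDet _ hdet.isUnit
    apply hφ
    simp only [map_sub, map_mul, RingHom.map_det]
    exact det_toBlocks₁₁_mul_det_of_invertible (X.map φ)
  have h := congrArg (MvPolynomial.eval₂Hom (Int.castRingHom R) fun p => M p.1 p.2) key
  simpa only [map_sub, map_mul, RingHom.map_det, RingHom.mapMatrix_apply, ← submatrix_map,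
    ← toBlocks₁₁_map, X, mvPolynomialX_map_eval₂Hom] using h

end Matrix

theorem Fin.succAbove_comp_finSumFinEquiv_last (n : ℕ) :
    Fin.succAbove (⟨n + 1, by omega⟩ : Fin (n + 2)) ∘ (finSumFinEquiv : Fin n ⊕ Fin 1 ≃ _) =
      (finSumFinEquiv : Fin n ⊕ Fin 2 ≃ _) ∘ Sum.map id ![0] := by
  ext (i | i) <;> simp [Fin.succAbove, Fin.lt_def]

theorem Fin.succAbove_comp_finSumFinEquiv_penultimate (n : ℕ) :
    Fin.succAbove (⟨n, by omega⟩ : Fin (n + 2)) ∘ (finSumFinEquiv : Fin n ⊕ Fin 1 ≃ _) =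
      (finSumFinEquiv : Fin n ⊕ Fin 2 ≃ _) ∘ Sum.map id ![1] := by
  ext (i | i) <;> simp [Fin.succAbove, Fin.lt_def]


/-- **Tanner identity (two-row/column bordering).**
For an `(n+2) × (n+2)` matrix `M` over a commutative ring with top-left `n × n`
submatrix `M₀`,
`det M₀ · det M = det(M del row/col n+2) · det(M del row/col n+1)
  − det(M del row n+2, col n+1) · det(M del row n+1, col n+2)`
(rows and columns numbered from 1). -/
theorem tanner_identity_two (R : Type*) [CommRing R] (n : ℕ)
    (M : Matrix (Fin (n + 2)) (Fin (n + 2)) R)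
    (M₀ : Matrix (Fin n) (Fin n) R)
    (hM₀ : M₀ = M.submatrix (Fin.castLE (by omega)) (Fin.castLE (by omega))) :
    M₀.det * M.det =
      (M.submatrix (Fin.succAbove ⟨n + 1, by omega⟩) (Fin.succAbove ⟨n + 1, by omega⟩)).det *
        (M.submatrix (Fin.succAbove ⟨n, by omega⟩) (Fin.succAbove ⟨n, by omega⟩)).det -
      (M.submatrix (Fin.succAbove ⟨n + 1, by omega⟩) (Fin.succAbove ⟨n, by omega⟩)).det *
        (M.submatrix (Fin.succAbove ⟨n, by omega⟩) (Fin.succAbove ⟨n + 1, by omega⟩)).det := by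
  have h := (M.submatrix finSumFinEquiv finSumFinEquiv).det_toBlocks₁₁_mul_det
  simp only [Matrix.det_submatrix_equiv_self, Matrix.submatrix_submatrix,
    ← Fin.succAbove_comp_finSumFinEquiv_last,
    ← Fin.succAbove_comp_finSumFinEquiv_penultimate] at h
  simp only [← Matrix.submatrix_submatrix, Matrix.det_submatrix_equiv_self] at h
  rw [hM₀]
  exact h
end

section
/- Let R be a commutative ring, let M be an (n+3)×(n+3) matrix over R, and let M₀ denote its top-left n×n submatrix. Then det(M₀)·det(M) = det(M restricted to rows {1,…,n,n+1} and columns {1,…,n,n+1})·det(M restricted to rows {1,…,n,n+2,n+3} and columns {1,…,n,n+2,n+3}) − det(M restricted to rows {1,…,n,n+1} and columns {1,…,n,n+2})·det(M restricted to rows {1,…,n,n+2,n+3} and columns {1,…,n,n+1,n+3}) + det(M restricted to rows {1,…,n,n+1} and columns {1,…,n,n+3})·det(M restricted to rows {1,…,n,n+2,n+3} and columns {1,…,n,n+1,n+2}). (This is the Tanner identity F[α,β]·F[αxuv,βyst] = F[αx,βy]·F[αuv,βst] − F[αx,βs]·F[αuv,βyt] + F[αx,βt]·F[αuv,βys].)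 -/
open Matrix in
/-- The signed minors along row `n`, paired with row `i` of `M`, give `det M` if `i = n` and
vanish otherwise. -/
theorem sum_mul_cofactor_row {R : Type*} [CommRing R] {m : ℕ}
    (M : Matrix (Fin (m + 1)) (Fin (m + 1)) R) (i k : Fin (m + 1)) :
    ∑ j, M i j * ((-1) ^ (k + j : ℕ) * (M.submatrix k.succAbove j.succAbove).det) =
      if i = k then M.det else 0 := by
  have h := congrFun (congrFun (mul_adjugate M) i) k
  simpa [mul_apply, adjugate_fin_succ_eq_det_submatrix, one_apply] using h

/-- The inclusion of the first `n` indices into `Fin m`, followed by `j` as the last value. -/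
def borderIndex {n m : ℕ} (h : n ≤ m) (j : Fin m) (i : Fin (n + 1)) : Fin m :=
  if hi : (i : ℕ) < n then ⟨i, hi.trans_le h⟩ else j

/-- Expansion of a bordered determinant along its last column. -/
theorem det_submatrix_borderIndex {R ι : Type*} [CommRing R] {n m : ℕ} (h : n ≤ m)
    (M : Matrix ι (Fin m) R) (r : Fin (n + 1) → ι) (j : Fin m) :
    (M.submatrix r (borderIndex h j)).det =
      ∑ i : Fin (n + 1), (-1) ^ (i + n : ℕ) *
        (M.submatrix (r ∘ i.succAbove) (Fin.castLE h)).det * M (r i) j := by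
  rw [Matrix.det_succ_column _ (Fin.last n)]
  refine Finset.sum_congr rfl fun i _ => ?_
  have hc : borderIndex h j ∘ (Fin.last n).succAbove = Fin.castLE h := by
    ext k
    simp [borderIndex]
  have hl : borderIndex h j (Fin.last n) = j := by simp [borderIndex]
  rw [Matrix.submatrix_submatrix, hc, Matrix.submatrix_apply, hl, Fin.val_last]
  ring

/-- A bordered determinant whose last column repeats an earlier one vanishes. -/
theorem det_submatrix_borderIndex_eq_zero {R ι : Type*} [CommRing R] {n m : ℕ} (h : n ≤ m)
    (M : Matrix ι (Fin m) R) (r : Fin (n + 1) → ι) (j : Fin m) (hj : (j : ℕ) < n) :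
    (M.submatrix r (borderIndex h j)).det = 0 := by
  refine Matrix.det_zero_of_column_eq (i := ⟨j, hj.trans n.lt_succ_self⟩) (j := Fin.last n)
    (by simp [Fin.ext_iff, hj.ne]) fun i => ?_
  simp [borderIndex, hj]

/-- The product of a leading minor with the full determinant, as a sum over all choices of the
bordering column. -/
theorem sum_det_borderIndex_mul_cofactor {R : Type*} [CommRing R] {n m : ℕ} (h : n ≤ m)
    (M : Matrix (Fin (m + 1)) (Fin (m + 1)) R) :
    ∑ j, (M.submatrix (Fin.castLE (Nat.succ_le_succ h))
        (borderIndex (h.trans m.le_succ) j)).det *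
      ((-1) ^ (n + j : ℕ) *
        (M.submatrix (Fin.succAbove ⟨n, Nat.lt_succ_of_le h⟩) j.succAbove).det) =
      (M.submatrix (Fin.castLE (h.trans m.le_succ)) (Fin.castLE (h.trans m.le_succ))).det *
        M.det := by
  simp_rw [det_submatrix_borderIndex, Finset.sum_mul]
  rw [Finset.sum_comm]
  have key : ∀ i : Fin (m + 1),
      ∑ j, M i j * ((-1) ^ (n + j : ℕ) *
        (M.submatrix (Fin.succAbove ⟨n, Nat.lt_succ_of_le h⟩) j.succAbove).det) =
      if i = ⟨n, Nat.lt_succ_of_le h⟩ then M.det else 0 :=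
    fun i => sum_mul_cofactor_row M i ⟨n, Nat.lt_succ_of_le h⟩
  simp_rw [mul_assoc, ← Finset.mul_sum, key]
  rw [Finset.sum_eq_single (Fin.last n)]
  · have hr : Fin.castLE (Nat.succ_le_succ h) ∘ (Fin.last n).succAbove =
        Fin.castLE (h.trans m.le_succ) := by
      ext k
      simp
    rw [hr, if_pos (by ext; simp), Fin.val_last, ← two_mul, pow_mul]
    simp
  · intro i _ hi
    rw [if_neg (by simpa [Fin.ext_iff] using hi)]
    simp
  · simp


/-- **Tanner identity (three-row/column bordering).**
For an `(n+3) × (n+3)` matrix `M` over a commutative ring with top-left `n × n`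
submatrix `M₀` (rows and columns numbered from 1):
`det M₀ · det M
  = det M(1..n,n+1; 1..n,n+1) · det M(1..n,n+2,n+3; 1..n,n+2,n+3)
  − det M(1..n,n+1; 1..n,n+2) · det M(1..n,n+2,n+3; 1..n,n+1,n+3)
  + det M(1..n,n+1; 1..n,n+3) · det M(1..n,n+2,n+3; 1..n,n+1,n+2)`. -/
theorem tanner_identity_three (R : Type*) [CommRing R] (n : ℕ)
    (M : Matrix (Fin (n + 3)) (Fin (n + 3)) R)
    (M₀ : Matrix (Fin n) (Fin n) R)
    (hM₀ : M₀ = M.submatrix (Fin.castLE (by omega)) (Fin.castLE (by omega))) :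
    M₀.det * M.det =
      (M.submatrix (Fin.castLE (by omega) : Fin (n + 1) → Fin (n + 3))
          (Fin.castLE (by omega))).det *
        (M.submatrix (Fin.succAbove ⟨n, by omega⟩) (Fin.succAbove ⟨n, by omega⟩)).det -
      (M.submatrix (Fin.castLE (by omega) : Fin (n + 1) → Fin (n + 3))
          (fun i : Fin (n + 1) =>
            if h : (i : ℕ) < n then (⟨i, by omega⟩ : Fin (n + 3)) else ⟨n + 1, by omega⟩)).det *
        (M.submatrix (Fin.succAbove ⟨n, by omega⟩) (Fin.succAbove ⟨n + 1, by omega⟩)).det +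
      (M.submatrix (Fin.castLE (by omega) : Fin (n + 1) → Fin (n + 3))
          (fun i : Fin (n + 1) =>
            if h : (i : ℕ) < n then (⟨i, by omega⟩ : Fin (n + 3)) else ⟨n + 2, by omega⟩)).det *
        (M.submatrix (Fin.succAbove ⟨n, by omega⟩) (Fin.succAbove ⟨n + 2, by omega⟩)).det := by
  subst hM₀
  have hn : n ≤ n + 2 := by omega
  have hfirst : (Fin.castLE (by omega) : Fin (n + 1) → Fin (n + 3)) =
      borderIndex (by omega) ⟨n, by omega⟩ := by
    ext i
    have := i.isLt
    unfold borderIndex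
    split_ifs
    · simp
    · simp only [Fin.val_castLE]
      omega
  have hsum := sum_det_borderIndex_mul_cofactor hn M
  rw [Fin.sum_univ_castSucc, Fin.sum_univ_castSucc, Fin.sum_univ_castSucc,
    Finset.sum_eq_zero, zero_add] at hsum
  · rw [← hsum]
    have h₀ : (-1 : R) ^ (n + n) = 1 := (Even.add_self n).neg_one_pow
    have h₁ : (-1 : R) ^ (n + (n + 1)) = -1 := by rw [← add_assoc, pow_succ, h₀, one_mul]
    have h₂ : (-1 : R) ^ (n + (n + 2)) = 1 := by rw [← add_assoc, pow_add, h₀]; simp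
    have e₀ : (Fin.last n).castSucc.castSucc = (⟨n, by omega⟩ : Fin (n + 3)) := rfl
    have e₁ : (Fin.last (n + 1)).castSucc = (⟨n + 1, by omega⟩ : Fin (n + 3)) := rfl
    have e₂ : Fin.last (n + 2) = (⟨n + 2, by omega⟩ : Fin (n + 3)) := rfl
    rw [e₀, e₁, e₂, h₀, h₁, h₂, ← hfirst]
    unfold borderIndex
    ring
  · intro j _
    rw [det_submatrix_borderIndex_eq_zero _ _ _ _ (by simp), zero_mul]
end

section
/- (Recursive general brackets.) Let R be a commutative ring, ⟨·,·⟩ : R → R → R a symmetric map (⟨a,b⟩ = ⟨b,a⟩ for all a,b), and φ₁,…,φ_n elements of R. Define recursively ⟨f,g⟩⁽⁰⁾ = ⟨f,g⟩ and ⟨f,g⟩⁽ᵏ⁺¹⁾ = ⟨f,g⟩⁽ᵏ⁾ − ⟨f,φ_{k+1}⟩⁽ᵏ⁾·⟨φ_{k+1},g⟩⁽ᵏ⁾·(⟨φ_{k+1},φ_{k+1}⟩⁽ᵏ⁾)⁻¹, assuming that for every k with 0 ≤ k ≤ n−1 the element ⟨φ_{k+1},φ_{k+1}⟩⁽ᵏ⁾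 is a unit of R. Then for every m with 1 ≤ m ≤ n the m×m matrix W⁽ᵐ⁾ with entries ⟨φ_i,φ_j⟩ (1 ≤ i,j ≤ m) is invertible, and for all f,g ∈ R one has ⟨f,g⟩⁽ᵐ⁾ = ⟨f,g⟩_D⁽ᵐ⁾, where ⟨f,g⟩_D⁽ᵐ⁾ = ⟨f,g⟩ − Σ_{a,b=1}^m ⟨f,φ_a⟩·C⁽ᵐ⁾_{ab}·⟨φ_b,g⟩ and C⁽ᵐ⁾ is the inverse of W⁽ᵐ⁾. -/
/-- The recursively defined family of brackets
`⟨f,g⟩⁽⁰⁾ = ⟨f,g⟩`,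
`⟨f,g⟩⁽ᵏ⁺¹⁾ = ⟨f,g⟩⁽ᵏ⁾ − ⟨f,φ_{k+1}⟩⁽ᵏ⁾·⟨φ_{k+1},g⟩⁽ᵏ⁾·(⟨φ_{k+1},φ_{k+1}⟩⁽ᵏ⁾)⁻¹`
(here `φ_{k+1}` of the paper is `φ k`, using 0-based indexing;
the inverse is taken via `Ring.inverse`). -/
noncomputable def recBracket {R : Type*} [CommRing R] (br : R → R → R) (φ : ℕ → R) :
    ℕ → R → R → R
  | 0 => br
  | k + 1 => fun f g =>
      recBracket br φ k f g -
        recBracket br φ k f (φ k) * recBracket br φ k (φ k) g *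
          Ring.inverse (recBracket br φ k (φ k) (φ k))

/-- The recursive bracket is a Dirac-type bracket whose coefficient matrix is a right inverse
of the bracket matrix. -/
theorem recBracket_exists_rightInverse {R : Type*} [CommRing R] (br : R → R → R) (φ : ℕ → R)
    (m : ℕ) (hunit : ∀ k < m, IsUnit (recBracket br φ k (φ k) (φ k))) :
    ∃ C : Matrix (Fin m) (Fin m) R,
      (Matrix.of fun i j : Fin m => br (φ i) (φ j)) * C = 1 ∧
      ∀ f g, recBracket br φ m f g =
        br f g - ∑ b : Fin m, (∑ a : Fin m, br f (φ a) * C a b) * br (φ b) g := by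
  induction m with
  | zero => exact ⟨0, Subsingleton.elim _ _, fun f g => by simp [recBracket]⟩
  | succ m ih =>
    obtain ⟨C, hC, hbr⟩ := ih fun k hk => hunit k (hk.trans m.lt_succ_self)
    have hu := Ring.mul_inverse_cancel _ (hunit m m.lt_succ_self)
    set B := recBracket br φ m with hB
    set u := Ring.inverse (B (φ m) (φ m)) with hu_def
    have hX (i b : Fin m) : ∑ a : Fin m, br (φ i) (φ a) * C a b = if i = b then 1 else 0 := by
      simpa [Matrix.mul_apply, Matrix.one_apply] using congrFun (congrFun hC i) b
    have hzero (i : Fin m) (g : R) : B (φ i) g = 0 := by simp [hbr, hX]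
    let x : Fin (m + 1) → R :=
      Fin.snoc (α := fun _ => R) (fun b => -∑ a : Fin m, br (φ m) (φ a) * C a b) 1
    let y : Fin (m + 1) → R :=
      Fin.snoc (α := fun _ => R) (fun a => -∑ b : Fin m, C a b * br (φ b) (φ m)) 1
    have hx (g : R) : ∑ b : Fin (m + 1), x b * br (φ b) g = B (φ m) g := by
      simp only [Fin.sum_univ_castSucc, x, Fin.snoc_castSucc, Fin.snoc_last, hbr,
        Fin.val_castSucc, Fin.val_last, neg_mul, Finset.sum_neg_distrib]
      ring
    have hy (f : R) : ∑ a : Fin (m + 1), br f (φ a) * y a = B f (φ m) := by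
      simp only [Fin.sum_univ_castSucc, y, Fin.snoc_castSucc, Fin.snoc_last, hbr,
        Fin.val_castSucc, Fin.val_last, mul_neg, Finset.sum_neg_distrib, Finset.mul_sum,
        Finset.sum_mul]
      rw [Finset.sum_comm]
      simp only [mul_assoc]
      ring
    let C₀ : Matrix (Fin (m + 1)) (Fin (m + 1)) R := Matrix.of
      (Fin.snoc (α := fun _ => Fin (m + 1) → R)
        (fun a => Fin.snoc (α := fun _ => R) (C a) 0) 0)
    let C' : Matrix (Fin (m + 1)) (Fin (m + 1)) R := Matrix.of fun a b => C₀ a b + y a * (u * x b)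
    have hC' (f : R) (b : Fin (m + 1)) : ∑ a : Fin (m + 1), br f (φ a) * C' a b =
        Fin.snoc (α := fun _ => R) (fun b => ∑ a : Fin m, br f (φ a) * C a b) 0 b +
          B f (φ m) * (u * x b) := by
      simp only [C', Matrix.of_apply, mul_add, Finset.sum_add_distrib, ← mul_assoc,
        ← Finset.sum_mul, hy]
      congr 1
      cases b using Fin.lastCases <;> simp [C₀, Fin.sum_univ_castSucc]
    refine ⟨C', ?_, fun f g => ?_⟩
    · ext i b
      simp only [Matrix.mul_apply, Matrix.of_apply, hC']
      cases i using Fin.lastCases with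
      | last =>
        rw [Fin.val_last, ← mul_assoc, hu]
        cases b using Fin.lastCases with
        | last => simp [x]
        | cast b => simp [x, (Fin.castSucc_lt_last b).ne']
      | cast i =>
        rw [Fin.val_castSucc, hzero]
        cases b using Fin.lastCases with
        | last => simp [(Fin.castSucc_lt_last i).ne]
        | cast b => simp [hX, Matrix.one_apply]
    · simp only [hC', add_mul, Finset.sum_add_distrib, mul_assoc, ← Finset.mul_sum, hx]
      simp only [recBracket, ← hB, ← hu_def, Fin.sum_univ_castSucc, Fin.snoc_castSucc,
        Fin.snoc_last, Fin.val_castSucc, zero_mul, add_zero]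
      rw [hbr f g]
      ring

/-- **Recursive general (symmetric) brackets.**
Let `⟨·,·⟩` be a symmetric bracket on a commutative ring `R` and `φ 0, …, φ (n-1)`
elements of `R` such that each `⟨φ_{k+1},φ_{k+1}⟩⁽ᵏ⁾` is a unit.  Then for every
`1 ≤ m ≤ n` the matrix `W⁽ᵐ⁾ = (⟨φ_i,φ_j⟩)` is invertible and the `m`-th recursive
bracket equals the Dirac bracket with respect to `φ 0, …, φ (m-1)`. -/
theorem recursive_symmetric_brackets (R : Type*) [CommRing R]
    (br : R → R → R) (hsymm : ∀ a b, br a b = br b a)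
    (n : ℕ) (φ : ℕ → R)
    (hunit : ∀ k < n, IsUnit (recBracket br φ k (φ k) (φ k))) :
    ∀ m, 1 ≤ m → m ≤ n →
      IsUnit (Matrix.of fun i j : Fin m => br (φ i) (φ j)) ∧
      ∀ f g, recBracket br φ m f g =
        br f g - ∑ a : Fin m, ∑ b : Fin m,
          br f (φ a) * (Matrix.of fun i j : Fin m => br (φ i) (φ j))⁻¹ a b * br (φ b) g := by
  intro m _ hmn
  obtain ⟨C, hC, hbr⟩ :=
    recBracket_exists_rightInverse br φ m fun k hk => hunit k (hk.trans_le hmn)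
  refine ⟨.of_mul_eq_one _ hC, fun f g => ?_⟩
  rw [Matrix.inv_eq_right_inv hC, hbr, Finset.sum_comm]
  simp only [Finset.sum_mul]
end

section
/- (Recursive skew-symmetric brackets.) Let R be a commutative ring, {·,·} : R → R → R an alternating map ({a,a} = 0 and {a,b} = −{b,a} for all a,b), and φ₁,…,φ_{2n} elements of R. Define recursively {f,g}⁽⁰⁾ = {f,g} and {f,g}⁽ᵏ⁺¹⁾ = {f,g}⁽ᵏ⁾ − ({f,φ_{2k+2}}⁽ᵏ⁾·{φ_{2k+1},g}⁽ᵏ⁾ − {f,φ_{2k+1}}⁽ᵏ⁾·{φ_{2k+2},g}⁽ᵏ⁾)·({φ_{2k+1},φ_{2k+2}}⁽ᵏ⁾)⁻¹, assuming that for every k with 0 ≤ k ≤ n−1 the element {φ_{2k+1},φ_{2k+2}}⁽ᵏ⁾ is a unit of R. Then for every m with 1 ≤ m ≤ n the 2m×2m matrix W⁽²ᵐ⁾ with entries {φ_i,φ_j} (1 ≤ i,j ≤ 2m) is invertible, and for all f,g ∈ R one has {f,g}⁽ᵐ⁾ = {f,g}_D⁽²ᵐ⁾, where {f,g}_D⁽²ᵐ⁾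 = {f,g} − Σ_{a,b=1}^{2m} {f,φ_a}·C⁽²ᵐ⁾_{ab}·{φ_b,g} and C⁽²ᵐ⁾ is the inverse of W⁽²ᵐ⁾. -/
/-- The recursively defined family of skew-symmetric brackets
`{f,g}⁽⁰⁾ = {f,g}`,
`{f,g}⁽ᵏ⁺¹⁾ = {f,g}⁽ᵏ⁾ − ({f,φ_{2k+2}}⁽ᵏ⁾·{φ_{2k+1},g}⁽ᵏ⁾ −
  {f,φ_{2k+1}}⁽ᵏ⁾·{φ_{2k+2},g}⁽ᵏ⁾)·({φ_{2k+1},φ_{2k+2}}⁽ᵏ⁾)⁻¹`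
(here `φ_{2k+1}, φ_{2k+2}` of the paper are `φ (2k), φ (2k+1)`, using 0-based
indexing; the inverse is taken via `Ring.inverse`). -/
noncomputable def recBracketSkew {R : Type*} [CommRing R] (br : R → R → R) (φ : ℕ → R) :
    ℕ → R → R → R
  | 0 => br
  | k + 1 => fun f g =>
      recBracketSkew br φ k f g -
        (recBracketSkew br φ k f (φ (2 * k + 1)) * recBracketSkew br φ k (φ (2 * k)) g -
         recBracketSkew br φ k f (φ (2 * k)) * recBracketSkew br φ k (φ (2 * k + 1)) g) *
          Ring.inverse (recBracketSkew br φ k (φ (2 * k)) (φ (2 * k + 1)))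

section RecBracketSkew

variable {R : Type*} [CommRing R] {br : R → R → R}

theorem recBracketSkew_skew (hskew : ∀ a b, br a b = - br b a) (φ : ℕ → R) (k : ℕ) (f g : R) :
    recBracketSkew br φ k f g = - recBracketSkew br φ k g f := by
  induction k generalizing f g with
  | zero => exact hskew f g
  | succ k ih =>
    simp only [recBracketSkew]
    rw [ih f g, ih f (φ (2 * k + 1)), ih f (φ (2 * k)), ih (φ (2 * k)) g, ih (φ (2 * k + 1)) g]
    ring

theorem recBracketSkew_self (halt : ∀ a, br a a = 0) (hskew : ∀ a b, br a b = - br b a)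
    (φ : ℕ → R) (k : ℕ) (f : R) : recBracketSkew br φ k f f = 0 := by
  induction k generalizing f with
  | zero => exact halt f
  | succ k ih =>
    simp only [recBracketSkew]
    rw [ih, recBracketSkew_skew hskew φ k (φ (2 * k)) f,
      recBracketSkew_skew hskew φ k (φ (2 * k + 1)) f]
    ring

/-- The elements `φ i` with `i < 2 * k` are Casimirs of the `k`-th recursive bracket. -/
theorem recBracketSkew_apply_left_eq_zero (halt : ∀ a, br a a = 0)
    (hskew : ∀ a b, br a b = - br b a) {φ : ℕ → R} {k : ℕ}
    (hunit : ∀ l < k, IsUnit (recBracketSkew br φ l (φ (2 * l)) (φ (2 * l + 1))))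
    {i : ℕ} (hi : i < 2 * k) (g : R) : recBracketSkew br φ k (φ i) g = 0 := by
  induction k generalizing i g with
  | zero => omega
  | succ k ih =>
    have hinv := Ring.mul_inverse_cancel _ (hunit k k.lt_succ_self)
    have hself := recBracketSkew_self halt hskew φ k
    simp only [recBracketSkew]
    obtain h | rfl | rfl : i < 2 * k ∨ i = 2 * k ∨ i = 2 * k + 1 := by omega
    · have h0 := fun g => ih (fun l hl => hunit l (hl.trans k.lt_succ_self)) h g
      simp [h0]
    · rw [hself]
      linear_combination -recBracketSkew br φ k (φ (2 * k)) g * hinv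
    · rw [hself, recBracketSkew_skew hskew φ k (φ (2 * k + 1)) (φ (2 * k))]
      linear_combination -recBracketSkew br φ k (φ (2 * k + 1)) g * hinv

theorem exists_recBracketSkew_eq_sub_sum (br : R → R → R) (φ : ℕ → R) (k : ℕ) (g : R) :
    ∃ u : ℕ → R, ∀ f, recBracketSkew br φ k f g =
      br f g - ∑ a ∈ Finset.range (2 * k), br f (φ a) * u a := by
  induction k generalizing g with
  | zero => exact ⟨0, fun f => by simp [recBracketSkew]⟩
  | succ k ih =>
    obtain ⟨u, hu⟩ := ih g
    obtain ⟨v, hv⟩ := ih (φ (2 * k))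
    obtain ⟨w, hw⟩ := ih (φ (2 * k + 1))
    set c := Ring.inverse (recBracketSkew br φ k (φ (2 * k)) (φ (2 * k + 1))) with hc
    set s := recBracketSkew br φ k (φ (2 * k)) g * c with hs
    set t := recBracketSkew br φ k (φ (2 * k + 1)) g * c with ht
    refine ⟨fun a => if a < 2 * k then u a - w a * s + v a * t else if a = 2 * k then -t else s,
      fun f => ?_⟩
    have hsum : ∑ a ∈ Finset.range (2 * k), br f (φ a) *
        (if a < 2 * k then u a - w a * s + v a * t else if a = 2 * k then -t else s) =
        ∑ a ∈ Finset.range (2 * k), br f (φ a) * u a -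
          (∑ a ∈ Finset.range (2 * k), br f (φ a) * w a) * s +
          (∑ a ∈ Finset.range (2 * k), br f (φ a) * v a) * t := by
      rw [Finset.sum_mul, Finset.sum_mul, ← Finset.sum_sub_distrib, ← Finset.sum_add_distrib]
      refine Finset.sum_congr rfl fun a ha => ?_
      rw [if_pos (Finset.mem_range.mp ha)]
      ring
    have hstep : recBracketSkew br φ (k + 1) f g = recBracketSkew br φ k f g -
        recBracketSkew br φ k f (φ (2 * k + 1)) * s + recBracketSkew br φ k f (φ (2 * k)) * t := by
      simp only [recBracketSkew, hs, ht, hc]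
      ring
    rw [hstep, show 2 * (k + 1) = 2 * k + 1 + 1 by ring, Finset.sum_range_succ,
      Finset.sum_range_succ, hsum, hu, hv, hw]
    simp
    ring

theorem recBracketSkew_eq_dirac (halt : ∀ a, br a a = 0)
    (hskew : ∀ a b, br a b = - br b a) {φ : ℕ → R} {k : ℕ}
    (hunit : ∀ l < k, IsUnit (recBracketSkew br φ l (φ (2 * l)) (φ (2 * l + 1))))
    (hW : IsUnit (Matrix.of fun i j : Fin (2 * k) => br (φ i) (φ j))) (f g : R) :
    recBracketSkew br φ k f g =
      br f g - ∑ a : Fin (2 * k), ∑ b : Fin (2 * k),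
        br f (φ a) * (Matrix.of fun i j : Fin (2 * k) => br (φ i) (φ j))⁻¹ a b * br (φ b) g := by
  set W := Matrix.of fun i j : Fin (2 * k) => br (φ i) (φ j) with hWdef
  obtain ⟨u, hu⟩ := exists_recBracketSkew_eq_sub_sum br φ k g
  have hWu : W.mulVec (fun a => u a) = fun b : Fin (2 * k) => br (φ b) g := by
    funext i
    have h := hu (φ i)
    rw [recBracketSkew_apply_left_eq_zero halt hskew hunit i.2, Finset.sum_range] at h
    exact (sub_eq_zero.mp h.symm).symm
  have hu_eq : (fun a : Fin (2 * k) => u a) = W⁻¹.mulVec (fun b : Fin (2 * k) => br (φ b) g) := by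
    rw [← hWu, Matrix.mulVec_mulVec,
      Matrix.nonsing_inv_mul _ ((Matrix.isUnit_iff_isUnit_det _).mp hW), Matrix.one_mulVec]
  rw [hu, Finset.sum_range]
  congr 1
  refine Finset.sum_congr rfl fun a _ => ?_
  rw [show u a = _ from congrFun hu_eq a, Matrix.mulVec, dotProduct, Finset.mul_sum]
  exact Finset.sum_congr rfl fun b _ => (mul_assoc _ _ _).symm

theorem isUnit_bracketMatrix (halt : ∀ a, br a a = 0)
    (hskew : ∀ a b, br a b = - br b a) {φ : ℕ → R} {k : ℕ}
    (hunit : ∀ l < k, IsUnit (recBracketSkew br φ l (φ (2 * l)) (φ (2 * l + 1)))) :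
    IsUnit (Matrix.of fun i j : Fin (2 * k) => br (φ i) (φ j)) := by
  induction k with
  | zero =>
    have : IsEmpty (Fin (2 * 0)) := Fin.isEmpty
    exact isUnit_of_subsingleton _
  | succ k ih =>
    have hunit' := fun l (hl : l < k) => hunit l (hl.trans k.lt_succ_self)
    have hW := ih hunit'
    have hdirac := recBracketSkew_eq_dirac halt hskew hunit' hW
    set W := Matrix.of fun i j : Fin (2 * k) => br (φ i) (φ j) with hWdef
    let B : Matrix (Fin (2 * k)) (Fin 2) R := Matrix.of fun i j => br (φ i) (φ (2 * k + j))
    let C : Matrix (Fin 2) (Fin (2 * k)) R := Matrix.of fun i j => br (φ (2 * k + i)) (φ j)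
    let D : Matrix (Fin 2) (Fin 2) R := Matrix.of fun i j => br (φ (2 * k + i)) (φ (2 * k + j))
    have hblocks : (Matrix.of fun i j : Fin (2 * (k + 1)) => br (φ i) (φ j)).submatrix
        (finSumFinEquiv (m := 2 * k) (n := 2)) (finSumFinEquiv (m := 2 * k) (n := 2)) =
        Matrix.fromBlocks W B C D := by
      ext (i | i) (j | j) <;> rfl
    let := hW.invertible
    rw [← Matrix.isUnit_submatrix_equiv (finSumFinEquiv (m := 2 * k) (n := 2))
      (finSumFinEquiv (m := 2 * k) (n := 2)), hblocks,
      Matrix.isUnit_fromBlocks_iff_of_invertible₁₁, Matrix.invOf_eq_nonsing_inv]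
    have hschur : D - C * W⁻¹ * B = Matrix.of fun i j : Fin 2 =>
        recBracketSkew br φ k (φ (2 * k + i)) (φ (2 * k + j)) := by
      ext i j
      rw [Matrix.of_apply, hdirac, Matrix.sub_apply, Matrix.mul_apply, Finset.sum_comm]
      simp only [Matrix.mul_apply, Finset.sum_mul]
      rfl
    have hw := hunit k k.lt_succ_self
    rw [hschur, Matrix.isUnit_iff_isUnit_det, Matrix.det_fin_two]
    simpa [recBracketSkew_self halt hskew,
      recBracketSkew_skew hskew φ k (φ (2 * k + 1)) (φ (2 * k))] using hw

end RecBracketSkew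

/-- **Recursive skew-symmetric brackets.**
Let `{·,·}` be an alternating bracket on a commutative ring `R` and
`φ 0, …, φ (2n-1)` elements of `R` such that each `{φ_{2k+1},φ_{2k+2}}⁽ᵏ⁾` is a
unit.  Then for every `1 ≤ m ≤ n` the `2m × 2m` matrix `W⁽²ᵐ⁾ = ({φ_i,φ_j})` is
invertible and the `m`-th recursive bracket equals the Dirac bracket with respect
to `φ 0, …, φ (2m-1)`. -/
theorem recursive_skew_symmetric_brackets (R : Type*) [CommRing R]
    (br : R → R → R)
    (halt : ∀ a, br a a = 0) (hskew : ∀ a b, br a b = - br b a)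
    (n : ℕ) (φ : ℕ → R)
    (hunit : ∀ k < n, IsUnit (recBracketSkew br φ k (φ (2 * k)) (φ (2 * k + 1)))) :
    ∀ m, 1 ≤ m → m ≤ n →
      IsUnit (Matrix.of fun i j : Fin (2 * m) => br (φ i) (φ j)) ∧
      ∀ f g, recBracketSkew br φ m f g =
        br f g - ∑ a : Fin (2 * m), ∑ b : Fin (2 * m),
          br f (φ a) * (Matrix.of fun i j : Fin (2 * m) => br (φ i) (φ j))⁻¹ a b * br (φ b) g := by
  intro m _ hmn
  have hunit' := fun l (hl : l < m) => hunit l (hl.trans_le hmn)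
  have hW := isUnit_bracketMatrix halt hskew hunit'
  exact ⟨hW, recBracketSkew_eq_dirac halt hskew hunit' hW⟩
end

section
/- Let X be a set, let F = (X → ℝ) be the commutative ring of real-valued functions on X with pointwise operations, and let ⟨·,·⟩ : F → F → F be a symmetric ℝ-bilinear map that is semimetric, i.e. ⟨f,f⟩(x) ≥ 0 for every f ∈ F and every x ∈ X. Let φ₁,…,φ_n ∈ F be such that the n×n matrix W over F with entries W_{ij} = ⟨φ_i,φ_j⟩ is invertible (in the matrix ring over F), with inverse C. Then the Dirac bracket ⟨f,g⟩_D = ⟨f,g⟩ − Σ_{i,j=1}^n ⟨f,φ_i⟩·C_{ij}·⟨φ_j,g⟩ is also semimetric: ⟨f,f⟩_D(x) ≥ 0 for every f ∈ F and every x ∈ X. -/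
/-- If `B v v` is non-negative for all `v`, then so is the Schur complement of the Gram matrix of
`w`: it is the value `B p p` at a vector `p ∈ v + span w` with `B (w i) p = 0` for all `i`. -/
theorem LinearMap.schur_complement_nonneg {V ι : Type*} [AddCommGroup V] [Module ℝ V]
    [Fintype ι] [DecidableEq ι] (B : V →ₗ[ℝ] V →ₗ[ℝ] ℝ)
    (hnonneg : ∀ v, 0 ≤ B v v) (w : ι → V) (C : Matrix ι ι ℝ)
    (hC : (Matrix.of fun i j => B (w i) (w j)) * C = 1) (v : V) :
    0 ≤ B v v - ∑ i, ∑ j, B v (w i) * C i j * B (w j) v := by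
  set c : ι → ℝ := C.mulVec fun j => B (w j) v with hc
  set p : V := ∑ i, c i • w i with hp
  have horth (k : ι) : B (w k) (v - p) = 0 := by
    have h : (Matrix.of fun i j => B (w i) (w j)).mulVec c = fun j => B (w j) v := by
      rw [hc, Matrix.mulVec_mulVec, hC, Matrix.one_mulVec]
    have hk : ∑ i, B (w k) (w i) * c i = B (w k) v := congrFun h k
    rw [map_sub, ← hk, hp, map_sum, sub_eq_zero]
    exact Finset.sum_congr rfl fun i _ => by rw [map_smul, smul_eq_mul, mul_comm]
  have hproj : B p (v - p) = 0 := by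
    simp only [hp, map_sum, LinearMap.sum_apply, map_smul, LinearMap.smul_apply]
    rw [← hp]
    simp [horth]
  have hval : B v p = ∑ i, ∑ j, B v (w i) * C i j * B (w j) v := by
    simp only [hp, map_sum, map_smul, smul_eq_mul, hc, Matrix.mulVec, dotProduct,
      Finset.sum_mul]
    exact Finset.sum_congr rfl fun i _ => Finset.sum_congr rfl fun j _ => by ring
  calc 0 ≤ B (v - p) (v - p) := hnonneg _
    _ = B v (v - p) := by rw [map_sub B, LinearMap.sub_apply, hproj, sub_zero]
    _ = _ := by rw [map_sub, hval]

/-- **The Dirac bracket of a semimetric bracket is semimetric.**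
Let `F = (X → ℝ)` with pointwise operations, and let `⟨·,·⟩` be a symmetric
ℝ-bilinear bracket on `F` with `⟨f,f⟩(x) ≥ 0` for all `f, x`.  If the constraint
matrix `W = (⟨φ_i,φ_j⟩)` over `F` is invertible with inverse `C`, then the Dirac
bracket `⟨f,g⟩_D = ⟨f,g⟩ − Σ_{i,j} ⟨f,φ_i⟩·C_{ij}·⟨φ_j,g⟩` also satisfies
`⟨f,f⟩_D(x) ≥ 0` for all `f, x`. -/
theorem dirac_bracket_semimetric (X : Type*)
    (br : (X → ℝ) → (X → ℝ) → (X → ℝ))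
    (hsymm : ∀ f g, br f g = br g f)
    (haddl : ∀ f g h, br (f + g) h = br f h + br g h)
    (haddr : ∀ f g h, br f (g + h) = br f g + br f h)
    (hsmull : ∀ (r : ℝ) (f g), br (r • f) g = r • br f g)
    (hsmulr : ∀ (r : ℝ) (f g), br f (r • g) = r • br f g)
    (hnonneg : ∀ (f : X → ℝ) (x : X), 0 ≤ br f f x)
    (n : ℕ) (φ : Fin n → X → ℝ)
    (C : Matrix (Fin n) (Fin n) (X → ℝ))
    (hWC : (Matrix.of fun i j => br (φ i) (φ j)) * C = 1)
    (hCW : C * (Matrix.of fun i j => br (φ i) (φ j)) = 1) :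
    ∀ (f : X → ℝ) (x : X),
      0 ≤ (br f f - ∑ i, ∑ j, br f (φ i) * C i j * br (φ j) f) x := by
  intro f x
  let B : (X → ℝ) →ₗ[ℝ] (X → ℝ) →ₗ[ℝ] ℝ :=
    LinearMap.mk₂ ℝ (fun f g => br f g x)
      (fun f g h => congrFun (haddl f g h) x) (fun r f g => congrFun (hsmull r f g) x)
      (fun f g h => congrFun (haddr f g h) x) (fun r f g => congrFun (hsmulr r f g) x)
  have hC : (Matrix.of fun i j => B (φ i) (φ j)) * C.map (Pi.evalRingHom (fun _ => ℝ) x) = 1 := by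
    have h := congrArg (fun M => M.map (Pi.evalRingHom (fun _ : X => ℝ) x)) hWC
    simp only [Matrix.map_mul] at h
    rw [Matrix.map_one _ (map_zero _) (map_one _)] at h
    exact h
  have h := LinearMap.schur_complement_nonneg B
    (fun v => hnonneg v x) φ _ hC f
  simpa [B, Finset.sum_apply] using h
end

section
/- Let R be a commutative ring, {·,·} : R → R → R an alternating map ({a,a} = 0 and {a,b} = −{b,a} for all a,b), and φ₁,…,φ_{2n} elements of R such that the 2n×2n matrix W with entries W_{ij} = {φ_i,φ_j} is invertible, with inverse C. Then for all f,g ∈ R the square of the Dirac bracket satisfies det(W) · ({f,g}_D)² = det(W(φ₁,…,φ_{2n},f,g)), where {f,g}_D = {f,g} − Σ_{i,j=1}^{2n} {f,φ_i}·C_{ij}·{φ_j,g} and W(φ₁,…,φ_{2n},f,g) is the (2n+2)×(2n+2) matrix whose rows and columns are indexed by the sequence (φ₁,…,φ_{2n},f,g) and whose (u,v) entry is {u,v}. -/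
/-- The Dirac bracket of `f, g` with respect to constraints `φ` whose bracket matrix
has inverse `C`: `{f,g}_D = {f,g} − Σ_{i,j} {f,φ_i}·C_{ij}·{φ_j,g}`. -/
def diracBracket {R : Type*} [CommRing R] {m : ℕ} (br : R → R → R) (φ : Fin m → R)
    (C : Matrix (Fin m) (Fin m) R) (f g : R) : R :=
  br f g - ∑ i, ∑ j, br f (φ i) * C i j * br (φ j) g

theorem Matrix.dotProduct_mulVec_self_of_alternating {R ι : Type*} [CommRing R] [Fintype ι]
    {W : Matrix ι ι R} (hdiag : ∀ i, W i i = 0) (hskew : ∀ i j, W i j = -W j i) (v : ι → R) :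
    v ⬝ᵥ W.mulVec v = 0 := by
  classical
  simp only [dotProduct, Matrix.mulVec, Finset.mul_sum]
  rw [← Finset.sum_product' (f := fun i j => v i * (W i j * v j))]
  refine Finset.sum_involution (fun p _ => p.swap) ?_ ?_ (by simp) (by simp)
  · rintro ⟨i, j⟩ -
    simp only [Prod.swap]
    rw [hskew j i]
    ring
  · rintro ⟨i, j⟩ - h heq
    obtain rfl : j = i := congrArg Prod.fst heq
    simp [hdiag] at h

theorem diracBracket_eq_dotProduct {R : Type*} [CommRing R] {m : ℕ} (br : R → R → R)
    (φ : Fin m → R) (C : Matrix (Fin m) (Fin m) R) (f g : R) :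
    diracBracket br φ C f g =
      br f g - (fun i => br f (φ i)) ⬝ᵥ C.mulVec (fun j => br (φ j) g) := by
  simp only [diracBracket, dotProduct, Matrix.mulVec, Finset.mul_sum, mul_assoc]

theorem diracBracket_self {R : Type*} [CommRing R] {m : ℕ} {br : R → R → R}
    (halt : ∀ a, br a a = 0) (hskew : ∀ a b, br a b = -br b a)
    {φ : Fin m → R} {C : Matrix (Fin m) (Fin m) R}
    (hWC : (Matrix.of fun i j => br (φ i) (φ j)) * C = 1) (f : R) :
    diracBracket br φ C f f = 0 := by
  set W : Matrix (Fin m) (Fin m) R := Matrix.of fun i j => br (φ i) (φ j)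
  set y : Fin m → R := fun j => br (φ j) f with hy
  have hx : (fun i => br f (φ i)) = -y := funext fun i => hskew f (φ i)
  have hWy : W.mulVec (C.mulVec y) = y := by
    rw [Matrix.mulVec_mulVec, hWC, Matrix.one_mulVec]
  have hzero : y ⬝ᵥ C.mulVec y = 0 := by
    have h := Matrix.dotProduct_mulVec_self_of_alternating (W := W) (fun i => halt (φ i))
      (fun i j => hskew (φ i) (φ j)) (C.mulVec y)
    rwa [hWy, dotProduct_comm] at h
  rw [diracBracket_eq_dotProduct, hx, ← hy, halt, neg_dotProduct, hzero, neg_zero, sub_zero]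

theorem diracBracket_skew {R : Type*} [CommRing R] {m : ℕ} {br : R → R → R}
    (hskew : ∀ a b, br a b = -br b a) {φ : Fin m → R} {C : Matrix (Fin m) (Fin m) R}
    (hWC : (Matrix.of fun i j => br (φ i) (φ j)) * C = 1) (f g : R) :
    diracBracket br φ C f g = -diracBracket br φ C g f := by
  set W : Matrix (Fin m) (Fin m) R := Matrix.of fun i j => br (φ i) (φ j)
  have hW : W.transpose = -W := Matrix.ext fun i j => hskew (φ j) (φ i)
  have hC : -C.transpose = C := by
    refine left_inv_eq_right_inv (a := W) ?_ hWC
    rw [← Matrix.transpose_one, ← hWC, Matrix.transpose_mul, hW, neg_mul, mul_neg]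
  have hCij (i j) : C i j = -C j i := (congrFun (congrFun hC i) j).symm
  simp only [diracBracket]
  rw [hskew f g, Finset.sum_comm, neg_sub, sub_eq_add_neg, add_comm, sub_eq_add_neg,
    ← Finset.sum_neg_distrib]
  congr 1
  refine Finset.sum_congr rfl fun i _ => ?_
  rw [← Finset.sum_neg_distrib]
  refine Finset.sum_congr rfl fun j _ => ?_
  rw [hskew f, hskew _ g, hCij j i]
  ring

/-- The Schur complement of the constraint matrix in the extended bracket matrix is the
matrix of Dirac brackets. -/
theorem det_fromBlocks_bracket {R κ : Type*} [CommRing R] [Fintype κ] [DecidableEq κ] {m : ℕ}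
    (br : R → R → R) (φ : Fin m → R) (C : Matrix (Fin m) (Fin m) R)
    (hWC : (Matrix.of fun i j => br (φ i) (φ j)) * C = 1)
    (hCW : C * (Matrix.of fun i j => br (φ i) (φ j)) = 1) (ψ : κ → R) :
    (Matrix.fromBlocks (Matrix.of fun i j => br (φ i) (φ j))
        (Matrix.of fun i l => br (φ i) (ψ l)) (Matrix.of fun k j => br (ψ k) (φ j))
        (Matrix.of fun k l => br (ψ k) (ψ l))).det =
      (Matrix.of fun i j => br (φ i) (φ j)).det *
        (Matrix.of fun k l => diracBracket br φ C (ψ k) (ψ l)).det := by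
  let _ : Invertible (Matrix.of fun i j => br (φ i) (φ j)) := ⟨C, hCW, hWC⟩
  rw [Matrix.det_fromBlocks₁₁]
  congr 2
  ext k l
  rw [Matrix.of_apply, diracBracket_eq_dotProduct, Matrix.mul_assoc]
  rfl

/-- **Square of the skew-symmetric Dirac bracket as a ratio of determinants.**
For an alternating bracket `{·,·}` with invertible constraint matrix
`W = ({φ_i,φ_j})` of size `2n` (inverse `C`), one has
`det W · ({f,g}_D)² = det W(φ₁,…,φ_{2n},f,g)`, where the big matrix is the
bracket matrix of the extended sequence `(φ₁,…,φ_{2n},f,g)`. -/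
theorem dirac_bracket_sq_det (R : Type*) [CommRing R] (n : ℕ)
    (br : R → R → R)
    (halt : ∀ a, br a a = 0) (hskew : ∀ a b, br a b = - br b a)
    (φ : Fin (2 * n) → R) (C : Matrix (Fin (2 * n)) (Fin (2 * n)) R)
    (hWC : (Matrix.of fun i j => br (φ i) (φ j)) * C = 1)
    (hCW : C * (Matrix.of fun i j => br (φ i) (φ j)) = 1)
    (f g : R) :
    (Matrix.of fun i j => br (φ i) (φ j)).det * (diracBracket br φ C f g) ^ 2 =
      (Matrix.of fun i j =>
          br ((Fin.snoc (Fin.snoc φ f : Fin (2 * n + 1) → R) g : Fin (2 * n + 1 + 1) → R) i)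
             ((Fin.snoc (Fin.snoc φ f : Fin (2 * n + 1) → R) g : Fin (2 * n + 1 + 1) → R) j)
        : Matrix (Fin (2 * n + 1 + 1)) (Fin (2 * n + 1 + 1)) R).det := by
  have hsnoc (x : Fin (2 * n) ⊕ Fin 2) :
      (Fin.snoc (Fin.snoc φ f : Fin (2 * n + 1) → R) g : Fin (2 * n + 1 + 1) → R)
        ((finSumFinEquiv : Fin (2 * n) ⊕ Fin 2 ≃ Fin (2 * n + 2)) x) = Sum.elim φ ![f, g] x := by
    rcases x with i | k
    · change (Fin.snoc (Fin.snoc φ f : Fin (2 * n + 1) → R) g : Fin (2 * n + 1 + 1) → R)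
        i.castSucc.castSucc = φ i
      rw [Fin.snoc_castSucc, Fin.snoc_castSucc]
    · fin_cases k
      · change (Fin.snoc (Fin.snoc φ f : Fin (2 * n + 1) → R) g : Fin (2 * n + 1 + 1) → R)
          (Fin.last (2 * n)).castSucc = f
        rw [Fin.snoc_castSucc, Fin.snoc_last]
      · change (Fin.snoc (Fin.snoc φ f : Fin (2 * n + 1) → R) g : Fin (2 * n + 1 + 1) → R)
          (Fin.last (2 * n + 1)) = g
        rw [Fin.snoc_last]
  have hdet := det_fromBlocks_bracket br φ C hWC hCW ![f, g]
  rw [Matrix.det_fin_two] at hdet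
  simp only [Matrix.of_apply, Matrix.cons_val_zero, Matrix.cons_val_one,
    diracBracket_self halt hskew hWC, diracBracket_skew hskew hWC g f] at hdet
  rw [← Matrix.det_submatrix_equiv_self
    (finSumFinEquiv : Fin (2 * n) ⊕ Fin 2 ≃ Fin (2 * n + 2))]
  trans
  · exact (hdet.trans (by ring)).symm
  · congr 1
    ext x y
    rw [Matrix.submatrix_apply, Matrix.of_apply, hsnoc, hsnoc]
    rcases x with i | k <;> rcases y with j | l <;> rfl
end

section
/- (One-step Jacobi lemma.) Let A be a commutative ring equipped with a Poisson bracket {·,·} (additive in each argument, alternating, Leibniz, Jacobi). Let φ₁, φ₂ ∈ A be such that {φ₁,φ₂} is a unit of A, and define the one-step bracket {f,g}⁽¹⁾ = {f,g} − ({f,φ₂}·{φ₁,g} − {f,φ₁}·{φ₂,g})·({φ₁,φ₂})⁻¹. Then {·,·}⁽¹⁾ satisfies the Jacobi identity: for all f,g,h ∈ A, {f,{g,h}⁽¹⁾}⁽¹⁾ + {g,{h,f}⁽¹⁾}⁽¹⁾ + {h,{f,g}⁽¹⁾}⁽¹⁾ = 0. -/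
/-- The one-step Dirac bracket with respect to a pair of constraints `φ₁, φ₂`:
`{f,g}⁽¹⁾ = {f,g} − ({f,φ₂}·{φ₁,g} − {f,φ₁}·{φ₂,g})·({φ₁,φ₂})⁻¹`
(the inverse is taken via `Ring.inverse`). -/
noncomputable def oneStepBracket {A : Type*} [CommRing A] (br : A → A → A)
    (φ₁ φ₂ : A) (f g : A) : A :=
  br f g - (br f φ₂ * br φ₁ g - br f φ₁ * br φ₂ g) * Ring.inverse (br φ₁ φ₂)

section PoissonBracket

variable {A : Type*} [CommRing A] {br : A → A → A}

theorem bracket_antisymm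
    (haddl : ∀ a b c, br (a + b) c = br a c + br b c)
    (haddr : ∀ a b c, br a (b + c) = br a b + br a c)
    (halt : ∀ a, br a a = 0) (a b : A) : br a b = -br b a := by
  have h := halt (a + b)
  rw [haddl, haddr, haddr, halt, halt] at h
  linear_combination h

theorem bracket_neg_right
    (haddr : ∀ a b c, br a (b + c) = br a b + br a c) (a b : A) : br a (-b) = -br a b :=
  map_neg (AddMonoidHom.mk' (br a) (haddr a)) b

theorem bracket_sub_right
    (haddr : ∀ a b c, br a (b + c) = br a b + br a c) (a b c : A) :
    br a (b - c) = br a b - br a c :=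
  map_sub (AddMonoidHom.mk' (br a) (haddr a)) b c

theorem bracket_inverse_right
    (hleib : ∀ a b c, br a (b * c) = br a b * c + b * br a c)
    {d : A} (hd : IsUnit d) (a : A) :
    br a (Ring.inverse d) = -Ring.inverse d ^ 2 * br a d := by
  have hone : br a 1 = 0 := by
    have h := hleib a 1 1
    rw [mul_one] at h
    linear_combination -h
  have hdi : d * Ring.inverse d = 1 := Ring.mul_inverse_cancel d hd
  have h := hleib a d (Ring.inverse d)
  rw [hdi, hone] at h
  linear_combination -Ring.inverse d * h - br a (Ring.inverse d) * hdi

theorem bracket_bracket_right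
    (haddl : ∀ a b c, br (a + b) c = br a c + br b c)
    (haddr : ∀ a b c, br a (b + c) = br a b + br a c)
    (halt : ∀ a, br a a = 0)
    (hjac : ∀ a b c, br a (br b c) + br b (br c a) + br c (br a b) = 0) (a b c : A) :
    br a (br b c) = br b (br a c) - br c (br a b) := by
  have h := hjac a b c
  rw [bracket_antisymm haddl haddr halt c a, bracket_neg_right haddr] at h
  linear_combination h

end PoissonBracket

/-- **One-step Jacobi lemma.**
Let `{·,·}` be a Poisson bracket on a commutative ring `A` (additive in each
argument, alternating, Leibniz, Jacobi) and `φ₁, φ₂ ∈ A` with `{φ₁,φ₂}` a unit.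
Then the one-step bracket `{·,·}⁽¹⁾` satisfies the Jacobi identity. -/
theorem one_step_jacobi (A : Type*) [CommRing A] (br : A → A → A)
    (haddl : ∀ a b c, br (a + b) c = br a c + br b c)
    (haddr : ∀ a b c, br a (b + c) = br a b + br a c)
    (halt : ∀ a, br a a = 0)
    (hleib : ∀ a b c, br a (b * c) = br a b * c + b * br a c)
    (hjac : ∀ a b c, br a (br b c) + br b (br c a) + br c (br a b) = 0)
    (φ₁ φ₂ : A) (hu : IsUnit (br φ₁ φ₂)) :
    ∀ f g h : A,
      oneStepBracket br φ₁ φ₂ f (oneStepBracket br φ₁ φ₂ g h) +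
      oneStepBracket br φ₁ φ₂ g (oneStepBracket br φ₁ φ₂ h f) +
      oneStepBracket br φ₁ φ₂ h (oneStepBracket br φ₁ φ₂ f g) = 0 := by
  intro f g h
  have anti := bracket_antisymm haddl haddr halt
  have jac := bracket_bracket_right haddl haddr halt hjac
  have hamiltonian (u v : A) : oneStepBracket br φ₁ φ₂ u v = br u v -
      (br u φ₁ * br v φ₂ - br u φ₂ * br v φ₁) * Ring.inverse (br φ₁ φ₂) := by
    rw [oneStepBracket, anti φ₁ v, anti φ₂ v]
    ring
  have expand (a u v : A) : br a (oneStepBracket br φ₁ φ₂ u v) = br a (br u v) -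
      (br a (br u φ₁) * br v φ₂ + br u φ₁ * br a (br v φ₂) -
        br a (br u φ₂) * br v φ₁ - br u φ₂ * br a (br v φ₁)) * Ring.inverse (br φ₁ φ₂) +
      (br u φ₁ * br v φ₂ - br u φ₂ * br v φ₁) *
        (Ring.inverse (br φ₁ φ₂) ^ 2 * br a (br φ₁ φ₂)) := by
    rw [hamiltonian, bracket_sub_right haddr, hleib, bracket_sub_right haddr, hleib, hleib,
      bracket_inverse_right hleib hu]
    ring
  have derivation (c u v : A) : br c (br u v) = br v (br u c) - br u (br v c) := by
    rw [jac c u v, anti c v, anti c u, bracket_neg_right haddr, bracket_neg_right haddr]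
    ring
  have mixed (u : A) : br φ₂ (br u φ₁) = br φ₁ (br u φ₂) - br u (br φ₁ φ₂) := by
    linear_combination jac u φ₁ φ₂
  have outer (u v : A) : oneStepBracket br φ₁ φ₂ u v = br u v -
      (br u φ₂ * br φ₁ v - br u φ₁ * br φ₂ v) * Ring.inverse (br φ₁ φ₂) := rfl
  rw [outer f (oneStepBracket br φ₁ φ₂ g h), outer g (oneStepBracket br φ₁ φ₂ h f),
    outer h (oneStepBracket br φ₁ φ₂ f g)]
  simp only [expand]
  rw [derivation φ₁ g h, derivation φ₁ h f, derivation φ₁ f g,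
    derivation φ₂ g h, derivation φ₂ h f, derivation φ₂ f g, mixed, mixed, mixed]
  linear_combination hjac f g h
end

section
/- Let R be a commutative ring and S an invertible K×K symmetric tridiagonal matrix over R, with diagonal entries c_i = S_{ii} and off-diagonal entries b_i = S_{i,i+1} = S_{i+1,i}. For indices 1 ≤ i ≤ j ≤ K, one has det(S) · (S⁻¹)_{ij} = (−1)^{i+j} · det(S(1,…,i−1)) · det(S(j+1,…,K)) · b_i·b_{i+1}·⋯·b_{j−1}, where S(1,…,i−1) is the top-left (i−1)×(i−1) principal submatrix of S, S(j+1,…,K) is the bottom-right (K−j)×(K−j) principal submatrix of S, the determinant of the empty matrix is 1, and the product b_i⋯b_{j−1} is empty (equal to 1) when i = j. -/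
/-- A block lower triangular `3 × 3` block matrix on `Fin n`, whose middle block is itself lower
triangular, has as determinant the product of the outer block determinants and of the diagonal
entries of the middle block. -/
theorem Matrix.det_eq_of_three_blocks_lowerTriangular {R : Type*} [CommRing R] {n p q s : ℕ}
    (h : p + q + s = n) (M : Matrix (Fin n) (Fin n) R)
    (h₁ : ∀ r c : Fin n, (r : ℕ) < p → p ≤ (c : ℕ) → M r c = 0)
    (h₂ : ∀ r c : Fin n, p ≤ (r : ℕ) → (r : ℕ) < p + q → r < c → M r c = 0) :
    M.det =
      (M.submatrix (fun a : Fin p => (⟨a, by omega⟩ : Fin n)) (fun a : Fin p => ⟨a, by omega⟩)).det *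
      (∏ a : Fin q, M ⟨p + a, by omega⟩ ⟨p + a, by omega⟩) *
      (M.submatrix (fun a : Fin s => (⟨p + q + a, by omega⟩ : Fin n))
        (fun a : Fin s => ⟨p + q + a, by omega⟩)).det := by
  subst h
  let f₁ : Fin p → Fin (p + q + s) := fun a => ⟨a, by omega⟩
  let f₂ : Fin q → Fin (p + q + s) := fun a => ⟨p + a, by omega⟩
  let f₃ : Fin s → Fin (p + q + s) := fun a => ⟨p + q + a, by omega⟩
  let e : (Fin p ⊕ Fin q) ⊕ Fin s ≃ Fin (p + q + s) :=
    (Equiv.sumCongr finSumFinEquiv (Equiv.refl _)).trans finSumFinEquiv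
  have key : M.submatrix e e =
      Matrix.fromBlocks
        (Matrix.fromBlocks (M.submatrix f₁ f₁) 0 (M.submatrix f₂ f₁) (M.submatrix f₂ f₂)) 0
        (Matrix.of fun a => Sum.elim (fun b => M (f₃ a) (f₁ b)) fun b => M (f₃ a) (f₂ b))
        (M.submatrix f₃ f₃) := by
    ext ((a | a) | a) ((b | b) | b)
    case inl.inl.inl.inr => exact h₁ _ _ (by simp [e]) (by simp [e])
    case inl.inl.inr => exact h₁ _ _ (by simp [e]) (by simp [e]; omega)
    case inl.inr.inr =>
      exact h₂ _ _ (by simp [e]) (by simp [e]) (by simp [e, Fin.lt_def]; omega)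
    all_goals rfl
  have htri : (M.submatrix f₂ f₂).det = ∏ a, M (f₂ a) (f₂ a) :=
    Matrix.det_of_isLowerTriangular _ fun a b hab =>
      h₂ _ _ (by simp [f₂]) (by simp [f₂])
        (Nat.add_lt_add_left (Fin.lt_def.1 (OrderDual.toDual_lt_toDual.1 hab)) p)
  rw [← Matrix.det_submatrix_equiv_self e M, key, Matrix.det_fromBlocks_zero₁₂,
    Matrix.det_fromBlocks_zero₁₂, htri]


/-- **Explicit formula for the inverse of a symmetric tridiagonal matrix.**
Let `S` be an invertible `K × K` symmetric tridiagonal matrix over a commutative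
ring, with off-diagonal entries `b_i = S_{i,i+1}`.  For `i ≤ j` (0-based indices
here, 1-based in the paper),
`det S · (S⁻¹)_{ij} = (−1)^{i+j} · det S(1,…,i−1) · det S(j+1,…,K) · b_i⋯b_{j−1}`,
where `S(1,…,i−1)` is the top-left principal submatrix preceding row `i`,
`S(j+1,…,K)` is the bottom-right principal submatrix following row `j`, empty
determinants are `1`, and the product of the `b`'s is over the off-diagonal
entries strictly between positions `i` and `j` (empty product `1` when `i = j`). -/
theorem tridiagonal_inverse_formula (R : Type*) [CommRing R] (K : ℕ)
    (S : Matrix (Fin K) (Fin K) R)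
    (hsym : S.transpose = S)
    (htri : ∀ i j : Fin K, ((i : ℕ) + 1 < (j : ℕ) ∨ (j : ℕ) + 1 < (i : ℕ)) → S i j = 0)
    (hinv : IsUnit S.det) :
    ∀ i j : Fin K, i ≤ j →
      S.det * S⁻¹ i j =
        (-1 : R) ^ ((i : ℕ) + (j : ℕ)) *
        (S.submatrix
            (fun a : Fin (i : ℕ) => (⟨(a : ℕ), by have := a.isLt; have := i.isLt; omega⟩ : Fin K))
            (fun a : Fin (i : ℕ) => (⟨(a : ℕ), by have := a.isLt; have := i.isLt; omega⟩ : Fin K))).det *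
        (S.submatrix
            (fun a : Fin (K - 1 - (j : ℕ)) =>
              (⟨(j : ℕ) + 1 + (a : ℕ), by have := a.isLt; have := j.isLt; omega⟩ : Fin K))
            (fun a : Fin (K - 1 - (j : ℕ)) =>
              (⟨(j : ℕ) + 1 + (a : ℕ), by have := a.isLt; have := j.isLt; omega⟩ : Fin K))).det *
        ∏ k ∈ Finset.univ.filter (fun k : Fin K => i ≤ k ∧ k < j),
          (if h : (k : ℕ) + 1 < K then S k ⟨(k : ℕ) + 1, h⟩ else 0) := by
  intro i j hij
  obtain _ | n := K
  · exact i.elim0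
  have hij' : (i : ℕ) ≤ j := hij
  have hj := j.isLt
  have hdet : S.det * S⁻¹ i j = S.adjugate i j := by
    rw [Matrix.inv_def, Matrix.smul_apply, smul_eq_mul, ← mul_assoc, Ring.mul_inverse_cancel _ hinv,
      one_mul]
  have below (k : Fin (n + 1)) (r : Fin n) (h : (r : ℕ) < k) : k.succAbove r = r.castSucc :=
    Fin.succAbove_of_castSucc_lt _ _ h
  have above (k : Fin (n + 1)) (r : Fin n) (h : (k : ℕ) ≤ r) : k.succAbove r = r.succ :=
    Fin.succAbove_of_le_castSucc _ _ h
  have hzero (r c : Fin n) (hrj : (r : ℕ) < j) (hci : (i : ℕ) ≤ c) (hrc : r < c) :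
      S.submatrix j.succAbove i.succAbove r c = 0 := by
    rw [Matrix.submatrix_apply, below j r hrj, above i c hci]
    exact htri _ _ (Or.inl (by simpa using hrc))
  rw [hdet, Matrix.adjugate_fin_succ_eq_det_submatrix,
    Matrix.det_eq_of_three_blocks_lowerTriangular (p := i) (q := j - i) (s := n + 1 - 1 - j)
      (by omega) _ (fun r c hr hc => hzero r c (by omega) hc (by rw [Fin.lt_def]; omega))
      (fun r c hr hr' hrc => hzero r c (by omega) (by rw [Fin.lt_def] at hrc; omega) hrc),
    Matrix.submatrix_submatrix, Matrix.submatrix_submatrix, add_comm (j : ℕ) i]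
  have hprod : ∏ a : Fin (j - i : ℕ), S.submatrix j.succAbove i.succAbove
        ⟨i + a, by omega⟩ ⟨i + a, by omega⟩ =
      ∏ k ∈ Finset.univ.filter (fun k : Fin (n + 1) => i ≤ k ∧ k < j),
        (if h : (k : ℕ) + 1 < n + 1 then S k ⟨(k : ℕ) + 1, h⟩ else 0) := by
    refine Finset.prod_bij (fun a _ => ⟨i + a, by omega⟩) ?_ ?_ ?_ ?_
    · intro a _
      simp only [Finset.mem_filter, Finset.mem_univ, true_and, Fin.le_def, Fin.lt_def]
      omega
    · intro a _ b _ h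
      simpa [Fin.ext_iff] using h
    · intro k hk
      simp only [Finset.mem_filter, Finset.mem_univ, true_and, Fin.le_def, Fin.lt_def] at hk
      exact ⟨⟨k - i, by omega⟩, Finset.mem_univ _, by ext; simp; omega⟩
    · intro a _
      rw [Matrix.submatrix_apply, below j _ (by simp; omega), above i _ (by simp),
        dif_pos (by simp; omega)]
      rfl
  have htop : j.succAbove ∘ (fun a : Fin i => (⟨a, by omega⟩ : Fin n)) =
      fun a => ⟨a, by omega⟩ := by
    funext a
    exact below j _ (by simp; omega)
  have htop' : i.succAbove ∘ (fun a : Fin i => (⟨a, by omega⟩ : Fin n)) =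
      fun a => ⟨a, by omega⟩ := by
    funext a
    exact below i _ (by simp)
  have hbot (k : Fin (n + 1)) (hk : k ≤ j) :
      k.succAbove ∘ (fun a : Fin (n + 1 - 1 - j) => (⟨i + (j - i) + a, by omega⟩ : Fin n)) =
      fun a => ⟨j + 1 + a, by omega⟩ := by
    funext a
    rw [Fin.le_def] at hk
    rw [Function.comp_apply, above k _ (by simp; omega)]
    ext
    simp
    omega
  rw [hprod, htop, htop', hbot j le_rfl, hbot i hij]
  ring
end

section
/- Let 𝕜 be a field and S an invertible K×K symmetric tridiagonal matrix over 𝕜 whose off-diagonal entries b_i = S_{i,i+1} are all nonzero. Then S⁻¹ is a one-pair matrix: there exist vectors u = (u₁,…,u_K) and w = (w₁,…,w_K) in 𝕜^K such that (S⁻¹)_{ij} = u_i·w_j whenever i ≤ j and (S⁻¹)_{ij} = u_j·w_i whenever i ≥ j. Explicitly, one may take u_i = (−1)^i · det(S(1,…,i−1)) · b_i·b_{i+1}·⋯·b_{K−1} / det(S) and w_j = (−1)^j · det(S(j+1,…,K)) / (b_j·b_{j+1}·⋯·b_{K−1}). -/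
/-- The determinant of the principal submatrix with rows and columns `l, …, l + n - 1` of a matrix
indexed by `ℕ`. -/
def principalMinor {R : Type*} [CommRing R] (f : ℕ → ℕ → R) (l n : ℕ) : R :=
  (Matrix.of fun i j : Fin n => f (l + i) (l + j)).det

section PrincipalMinor

variable {R : Type*} [CommRing R] {f : ℕ → ℕ → R}

@[simp]
lemma principalMinor_zero (l : ℕ) : principalMinor f l 0 = 1 := by
  simp [principalMinor]

@[simp]
lemma principalMinor_one (l : ℕ) : principalMinor f l 1 = f l l := by
  simp [principalMinor]

lemma principalMinor_add_two (htri : ∀ i j, (i + 1 < j ∨ j + 1 < i) → f i j = 0) (l n : ℕ) :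
    principalMinor f l (n + 2) = f l l * principalMinor f (l + 1) (n + 1) -
      f l (l + 1) * f (l + 1) l * principalMinor f (l + 2) n := by
  have hrow (j : Fin n) : f l (l + (j + 1 + 1)) = 0 := htri _ _ (by omega)
  have hcol (j : Fin n) : f (l + (j + 1 + 1)) l = 0 := htri _ _ (by omega)
  have hminor : ((Matrix.of fun i j : Fin (n + 2) => f (l + i) (l + j)).submatrix Fin.succ
      (Fin.succAbove 1)).det = f (l + 1) l * principalMinor f (l + 2) n := by
    rw [Matrix.det_succ_column_zero, Fin.sum_univ_succ, Finset.sum_eq_zero]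
    · simp only [principalMinor]
      simp
      congr 2
      ext i j
      simp [add_comm, add_left_comm]
    · intro i _
      simp [hcol]
  rw [principalMinor, Matrix.det_succ_row_zero, Fin.sum_univ_succ, Fin.sum_univ_succ,
    Finset.sum_eq_zero (fun i _ => by simp [hrow])]
  have h0 : ((Matrix.of fun i j : Fin (n + 2) => f (l + i) (l + j)).submatrix Fin.succ
      (Fin.succAbove 0)).det = principalMinor f (l + 1) (n + 1) := by
    rw [principalMinor]
    congr 1
    ext i j
    simp [add_assoc, add_comm 1]
  rw [h0, show Fin.succ (0 : Fin (n + 1)) = 1 from rfl, hminor]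
  simp
  ring

lemma principalMinor_add_two' (htri : ∀ i j, (i + 1 < j ∨ j + 1 < i) → f i j = 0) (l n : ℕ) :
    principalMinor f l (n + 2) = f (l + n + 1) (l + n + 1) * principalMinor f l (n + 1) -
      f (l + n) (l + n + 1) * f (l + n + 1) (l + n) * principalMinor f l n := by
  induction n using Nat.twoStepInduction generalizing l with
  | zero =>
    rw [principalMinor_add_two htri]
    simp
    ring
  | one =>
    simp only [principalMinor_add_two htri, principalMinor_zero, principalMinor_one, zero_add,
      add_assoc, Nat.reduceAdd]
    ring
  | more n ih₁ ih₂ =>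
    rw [principalMinor_add_two htri, ih₁, ih₂, principalMinor_add_two htri l (n + 1),
      principalMinor_add_two htri l n]
    ring_nf

/-- Expansion of the determinant of a tridiagonal matrix along two complementary blocks. -/
lemma principalMinor_add (htri : ∀ i j, (i + 1 < j ∨ j + 1 < i) → f i j = 0) (l m n : ℕ) :
    principalMinor f l (m + n + 2) =
      principalMinor f l (m + 1) * principalMinor f (l + m + 1) (n + 1) -
      f (l + m) (l + m + 1) * f (l + m + 1) (l + m) *
        (principalMinor f l m * principalMinor f (l + m + 2) n) := by
  induction m generalizing n with
  | zero => simp [principalMinor_add_two htri, mul_assoc]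
  | succ m ih =>
    rw [show m + 1 + n + 2 = m + (n + 1) + 2 by ring, ih, principalMinor_add_two' htri l,
      principalMinor_add_two htri (l + m + 1) n]
    ring_nf

end PrincipalMinor

/-- Three-term form of a row sum supported around the diagonal. -/
lemma sum_range_eq_of_tridiagonal {R : Type*} [AddCommMonoid R] {K i : ℕ} (hi : i < K) {g : ℕ → R}
    (hg : ∀ k, (i + 1 < k ∨ k + 1 < i) → g k = 0) (hK : ∀ k, K ≤ k → g k = 0) :
    ∑ k ∈ Finset.range K, g k = (if i = 0 then 0 else g (i - 1)) + g i + g (i + 1) := by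
  have hsub : ∑ k ∈ Finset.range K, g k = ∑ k ∈ Finset.Icc (i - 1) (i + 1), g k := by
    trans ∑ k ∈ Finset.range K ∩ Finset.Icc (i - 1) (i + 1), g k
    · refine (Finset.sum_subset Finset.inter_subset_left fun k h₁ h₂ => hg k ?_).symm
      simp at h₁ h₂
      omega
    · refine Finset.sum_subset Finset.inter_subset_right fun k h₁ h₂ => hK k ?_
      simp at h₁ h₂
      omega
  rw [hsub]
  rcases i with _ | i
  · simp [Finset.sum_Icc_succ_top]
  · rw [Nat.add_sub_cancel, Finset.sum_Icc_succ_top (by omega), Finset.sum_Icc_succ_top (by omega)]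
    simp

section OnePair

variable {𝕜 : Type*} [Field 𝕜]

/-- The first generator of the inverse of the tridiagonal matrix `f` of size `K`. -/
def onePairLeft (f : ℕ → ℕ → 𝕜) (K i : ℕ) : 𝕜 :=
  (-1) ^ (i + 1) * principalMinor f 0 i * (∏ k ∈ Finset.Ico i (K - 1), f k (k + 1)) /
    principalMinor f 0 K

/-- The second generator of the inverse of the tridiagonal matrix `f` of size `K`. -/
def onePairRight (f : ℕ → ℕ → 𝕜) (K j : ℕ) : 𝕜 :=
  (-1) ^ (j + 1) * principalMinor f (j + 1) (K - 1 - j) / ∏ k ∈ Finset.Ico j (K - 1), f k (k + 1)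

variable {f : ℕ → ℕ → 𝕜} {K : ℕ}

lemma prod_Ico_offDiag_ne_zero (hb : ∀ k, k + 1 < K → f k (k + 1) ≠ 0) (i : ℕ) :
    ∏ k ∈ Finset.Ico i (K - 1), f k (k + 1) ≠ 0 :=
  Finset.prod_ne_zero_iff.2 fun k hk => hb k (by simp at hk; omega)

lemma prod_Ico_offDiag_succ {i : ℕ} (hi : i + 1 < K) :
    ∏ k ∈ Finset.Ico i (K - 1), f k (k + 1) =
      f i (i + 1) * ∏ k ∈ Finset.Ico (i + 1) (K - 1), f k (k + 1) :=
  Finset.prod_eq_prod_Ico_succ_bot (by omega) _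

lemma onePairLeft_recurrence (hsym : ∀ i j, f i j = f j i)
    (htri : ∀ i j, (i + 1 < j ∨ j + 1 < i) → f i j = 0) {i : ℕ} (hi : i + 1 < K) :
    (if i = 0 then 0 else f i (i - 1) * onePairLeft f K (i - 1)) + f i i * onePairLeft f K i +
      f i (i + 1) * onePairLeft f K (i + 1) = 0 := by
  rcases i with _ | i
  · rw [onePairLeft, onePairLeft, prod_Ico_offDiag_succ hi]
    simp
    ring
  · simp only [onePairLeft, Nat.add_sub_cancel, Nat.add_eq_zero_iff, one_ne_zero, and_false,
      if_false, prod_Ico_offDiag_succ (f := f) (show i + 1 < K by omega),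
      prod_Ico_offDiag_succ (f := f) hi, principalMinor_add_two' htri, zero_add,
      hsym (i + 1) i]
    ring

lemma onePairRight_recurrence (hsym : ∀ i j, f i j = f j i)
    (htri : ∀ i j, (i + 1 < j ∨ j + 1 < i) → f i j = 0)
    (hK : ∀ i j, K ≤ j → f i j = 0) (hb : ∀ k, k + 1 < K → f k (k + 1) ≠ 0)
    {i : ℕ} (hi : i + 1 < K) :
    f (i + 1) i * onePairRight f K i + f (i + 1) (i + 1) * onePairRight f K (i + 1) +
      f (i + 1) (i + 2) * onePairRight f K (i + 2) = 0 := by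
  have hbi := hb i hi
  have hP := prod_Ico_offDiag_ne_zero hb (i + 1)
  obtain hlast | hlt := (show i + 2 ≤ K from hi).eq_or_lt
  · subst hlast
    rw [hK (i + 1) (i + 2) le_rfl, hsym (i + 1) i]
    simp [onePairRight, show i + 1 - i = 1 by omega]
    field_simp
    ring
  · obtain ⟨n, rfl⟩ : ∃ n, K = i + n + 3 := ⟨K - (i + 3), by omega⟩
    have hP' := prod_Ico_offDiag_ne_zero hb (i + 2)
    have hbi' := hb (i + 1) (by omega)
    simp only [onePairRight, prod_Ico_offDiag_succ (f := f) hi,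
      prod_Ico_offDiag_succ (f := f) hlt, hsym (i + 1) i,
      show i + n + 3 - 1 - i = n + 2 by omega, show i + n + 3 - 1 - (i + 1) = n + 1 by omega,
      show i + n + 3 - 1 - (i + 2) = n by omega, principalMinor_add_two htri,
      hsym (i + 1 + 1) (i + 1)]
    simp only [add_assoc, Nat.reduceAdd] at *
    field_simp
    ring

lemma onePair_diagonal (hsym : ∀ i j, f i j = f j i)
    (htri : ∀ i j, (i + 1 < j ∨ j + 1 < i) → f i j = 0)
    (hK : ∀ i j, K ≤ j → f i j = 0) (hb : ∀ k, k + 1 < K → f k (k + 1) ≠ 0)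
    (hdet : principalMinor f 0 K ≠ 0) {i : ℕ} (hi : i < K) :
    (if i = 0 then 0 else f i (i - 1) * (onePairLeft f K (i - 1) * onePairRight f K i)) +
      f i i * (onePairLeft f K i * onePairRight f K i) +
      f i (i + 1) * (onePairLeft f K i * onePairRight f K (i + 1)) = 1 := by
  have hP := prod_Ico_offDiag_ne_zero hb i
  have hprev : (if i = 0 then 0 else
      f i (i - 1) * (onePairLeft f K (i - 1) * onePairRight f K i)) +
      f i i * (onePairLeft f K i * onePairRight f K i) =
      principalMinor f 0 (i + 1) * principalMinor f (i + 1) (K - 1 - i) / principalMinor f 0 K := by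
    rcases i with _ | i
    · simp only [onePairLeft, onePairRight, if_true]
      field_simp
      simp [mul_comm]
    · simp only [onePairLeft, onePairRight, Nat.add_sub_cancel, Nat.add_eq_zero_iff, one_ne_zero,
        and_false, if_false, prod_Ico_offDiag_succ (f := f) hi, principalMinor_add_two' htri,
        zero_add, hsym (i + 1) i]
      field_simp
      ring_nf
      simp only [mul_comm i 2, pow_mul, neg_one_sq, one_pow]
      ring
  have hnext : f i (i + 1) * (onePairLeft f K i * onePairRight f K (i + 1)) =
      (principalMinor f 0 K - principalMinor f 0 (i + 1) * principalMinor f (i + 1) (K - 1 - i)) /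
        principalMinor f 0 K := by
    obtain hlast | hlt := (show i + 1 ≤ K from hi).eq_or_lt
    · subst hlast
      simp [hK i (i + 1) le_rfl]
    · obtain ⟨n, rfl⟩ : ∃ n, K = i + n + 2 := ⟨K - (i + 2), by omega⟩
      have hP' := prod_Ico_offDiag_ne_zero hb (i + 1)
      have hbi := hb i hlt
      have hadd := principalMinor_add htri 0 i n
      rw [show i + n + 2 - 1 - i = n + 1 by omega]
      simp only [onePairLeft, onePairRight, prod_Ico_offDiag_succ (f := f) hlt,
        show i + n + 2 - 1 - (i + 1) = n by omega]
      simp only [zero_add, hsym (i + 1) i] at hadd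
      field_simp
      rw [hadd]
      ring_nf
      simp only [mul_comm i 2, pow_mul, neg_one_sq, one_pow]
      ring
  rw [hprev, hnext]
  field_simp
  ring

end OnePair

/-- **The inverse of an invertible symmetric tridiagonal matrix with nonzero
off-diagonal entries is a one-pair matrix.**
Over a field, if `S` is an invertible `K × K` symmetric tridiagonal matrix whose
off-diagonal entries `b_i = S_{i,i+1}` are all nonzero, then there exist vectors
`u, w` with `(S⁻¹)_{ij} = u_i·w_j` for `i ≤ j` and `(S⁻¹)_{ij} = u_j·w_i` for
`i ≥ j`; explicitly (with 1-based indices `i`, as in the paper)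
`u_i = (−1)^i · det S(1,…,i−1) · b_i⋯b_{K−1} / det S` and
`w_j = (−1)^j · det S(j+1,…,K) / (b_j⋯b_{K−1})`. -/
theorem tridiagonal_inverse_one_pair (𝕜 : Type*) [Field 𝕜] (K : ℕ)
    (S : Matrix (Fin K) (Fin K) 𝕜)
    (hsym : S.transpose = S)
    (htri : ∀ i j : Fin K, ((i : ℕ) + 1 < (j : ℕ) ∨ (j : ℕ) + 1 < (i : ℕ)) → S i j = 0)
    (hdet : S.det ≠ 0)
    (hb : ∀ (k : Fin K) (h : (k : ℕ) + 1 < K), S k ⟨(k : ℕ) + 1, h⟩ ≠ 0) :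
    ∃ u w : Fin K → 𝕜,
      (∀ i : Fin K, u i =
        (-1 : 𝕜) ^ ((i : ℕ) + 1) *
        (S.submatrix
            (fun a : Fin (i : ℕ) => (⟨(a : ℕ), by have := a.isLt; have := i.isLt; omega⟩ : Fin K))
            (fun a : Fin (i : ℕ) => (⟨(a : ℕ), by have := a.isLt; have := i.isLt; omega⟩ : Fin K))).det *
        (∏ k ∈ Finset.univ.filter (fun k : Fin K => i ≤ k ∧ (k : ℕ) + 1 < K),
          (if h : (k : ℕ) + 1 < K then S k ⟨(k : ℕ) + 1, h⟩ else 0)) / S.det) ∧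
      (∀ j : Fin K, w j =
        (-1 : 𝕜) ^ ((j : ℕ) + 1) *
        (S.submatrix
            (fun a : Fin (K - 1 - (j : ℕ)) =>
              (⟨(j : ℕ) + 1 + (a : ℕ), by have := a.isLt; have := j.isLt; omega⟩ : Fin K))
            (fun a : Fin (K - 1 - (j : ℕ)) =>
              (⟨(j : ℕ) + 1 + (a : ℕ), by have := a.isLt; have := j.isLt; omega⟩ : Fin K))).det /
        ∏ k ∈ Finset.univ.filter (fun k : Fin K => j ≤ k ∧ (k : ℕ) + 1 < K),
          (if h : (k : ℕ) + 1 < K then S k ⟨(k : ℕ) + 1, h⟩ else 0)) ∧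
      (∀ i j : Fin K, i ≤ j → S⁻¹ i j = u i * w j) ∧
      (∀ i j : Fin K, j ≤ i → S⁻¹ i j = u j * w i) := by
  set f : ℕ → ℕ → 𝕜 := fun i j => if h : i < K ∧ j < K then S ⟨i, h.1⟩ ⟨j, h.2⟩ else 0 with hf
  have hfS (i j : Fin K) : f i j = S i j := by simp [hf]
  have hfsym (i j : ℕ) : f i j = f j i := by
    by_cases h : i < K ∧ j < K
    · simp only [hf, dif_pos h, dif_pos h.symm]
      exact congrFun₂ hsym ⟨j, h.2⟩ ⟨i, h.1⟩
    · simp only [hf, dif_neg h, dif_neg (mt And.symm h)]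
  have hftri (i j : ℕ) (hij : i + 1 < j ∨ j + 1 < i) : f i j = 0 := by
    by_cases h : i < K ∧ j < K
    · simp only [hf, dif_pos h]
      exact htri _ _ hij
    · simp only [hf, dif_neg h]
  have hfK (i j : ℕ) (hj : K ≤ j) : f i j = 0 := dif_neg (by omega)
  have hfb (k : ℕ) (hk : k + 1 < K) : f k (k + 1) ≠ 0 := by
    have h : k < K ∧ k + 1 < K := ⟨by omega, hk⟩
    simp only [hf, dif_pos h]
    exact hb ⟨k, h.1⟩ hk
  have hfdet : principalMinor f 0 K = S.det := by
    rw [principalMinor]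
    congr 1
    ext i j
    simp [hfS]
  have hprod (i : Fin K) :
      (∏ k ∈ Finset.univ.filter (fun k : Fin K => i ≤ k ∧ (k : ℕ) + 1 < K),
        (if h : (k : ℕ) + 1 < K then S k ⟨(k : ℕ) + 1, h⟩ else 0)) =
      ∏ k ∈ Finset.Ico (i : ℕ) (K - 1), f k (k + 1) := by
    have hIco : Finset.Ico (i : ℕ) (K - 1) =
        (Finset.range K).filter (fun k => (i : ℕ) ≤ k ∧ k + 1 < K) := by
      ext k
      simp
      omega
    rw [hIco, Finset.prod_filter, Finset.prod_filter,
      ← Fin.prod_univ_eq_prod_range (fun k => if (i : ℕ) ≤ k ∧ k + 1 < K then f k (k + 1) else 1)]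
    refine Finset.prod_congr rfl fun k _ => ?_
    by_cases h : (k : ℕ) + 1 < K
    · simp only [h, ↓reduceDIte, and_true, ← hfS, Fin.le_def]
    · simp [h]
  set R : Matrix (Fin K) (Fin K) 𝕜 := Matrix.of fun i j =>
    onePairLeft f K (min i j : ℕ) * onePairRight f K (max i j : ℕ) with hR
  have hmul : S * R = 1 := by
    ext i j
    have hi := i.isLt
    have hj := j.isLt
    have hsum := Fin.sum_univ_eq_sum_range (fun k => f i k *
      (onePairLeft f K (min k j) * onePairRight f K (max k j))) K
    rw [sum_range_eq_of_tridiagonal hi (fun k hk => by rw [hftri _ _ hk, zero_mul])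
      (fun k hk => by rw [hfK _ _ hk, zero_mul])] at hsum
    simp only [hfS] at hsum
    rw [Matrix.mul_apply]
    refine hsum.trans ?_
    rw [← hfS i i]
    generalize hi' : (i : ℕ) = a at *
    generalize hj' : (j : ℕ) = b at *
    rw [Matrix.one_apply]
    simp only [Fin.ext_iff, hi', hj']
    rcases lt_trichotomy a b with h | h | h
    · rw [if_neg h.ne, min_eq_left (by omega : a - 1 ≤ b), min_eq_left h.le,
        min_eq_left (by omega : a + 1 ≤ b), max_eq_right (by omega : a - 1 ≤ b),
        max_eq_right h.le, max_eq_right (by omega : a + 1 ≤ b)]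
      have := onePairLeft_recurrence hfsym hftri (show a + 1 < K by omega)
      split_ifs at this ⊢ <;> linear_combination onePairRight f K b * this
    · subst h
      rw [if_pos rfl, min_self, max_self, min_eq_left (by omega : a - 1 ≤ a),
        max_eq_right (by omega : a - 1 ≤ a), min_eq_right (by omega : a ≤ a + 1),
        max_eq_left (by omega : a ≤ a + 1)]
      exact onePair_diagonal hfsym hftri hfK hfb (hfdet ▸ hdet) hi
    · obtain ⟨a, rfl⟩ : ∃ m, a = m + 1 := ⟨a - 1, by omega⟩
      rw [if_neg h.ne', if_neg a.succ_ne_zero, Nat.add_sub_cancel,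
        min_eq_right (by omega : b ≤ a), min_eq_right h.le,
        min_eq_right (by omega : b ≤ a + 1 + 1), max_eq_left (by omega : b ≤ a),
        max_eq_left h.le, max_eq_left (by omega : b ≤ a + 1 + 1)]
      have := onePairRight_recurrence hfsym hftri hfK hfb hi
      linear_combination onePairLeft f K b * this
  have hinv : S⁻¹ = R := Matrix.inv_eq_right_inv hmul
  refine ⟨fun i => onePairLeft f K i, fun j => onePairRight f K j, fun i => ?_, fun j => ?_,
    fun i j hij => ?_, fun i j hij => ?_⟩
  · beta_reduce
    rw [hprod, ← hfdet, onePairLeft]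
    congr 3
    rw [principalMinor]
    congr 1
    ext a b
    simp [← hfS]
  · beta_reduce
    rw [hprod, onePairRight]
    congr 2
    rw [principalMinor]
    congr 1
    ext a b
    simp [← hfS]
  · simp [hinv, hR, min_eq_left (show (i : ℕ) ≤ j from hij), max_eq_right (show (i : ℕ) ≤ j from hij)]
  · simp [hinv, hR, min_eq_right (show (j : ℕ) ≤ i from hij), max_eq_left (show (j : ℕ) ≤ i from hij)]
end
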